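/- Let A = B·D be a real m×n matrix of full column rank, where D is an n×n diagonal matrix with positive diagonal entries, let Ṽ be a real n×n orthogonal matrix, and let ΔX be a real m×n matrix with |ΔX| ≤ ε |A| |Ṽ| entrywise for some ε ≥ 0. Then for all i, j ≤ n, |(Ṽᵀ Aᵀ ΔX)_{ij}| ≤ n√n · ε · κ(B) · ‖A Ṽ(:,i)‖₂ · ‖A Ṽ(:,j)‖₂. -/

import Mathlib

open Matrix BigOperators

/-- Euclidean norm of a vector. -/
noncomputable def vnorm {k : ℕ} (v : Fin k → ℝ) : ℝ := Real.sqrt (∑ i, (v i)^2)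

/-- Spectral norm (operator 2-norm) of a real matrix. -/
noncomputable def spec {m n : ℕ} (A : Matrix (Fin m) (Fin n) ℝ) : ℝ :=
  ‖(Matrix.toEuclideanLin A).toContinuousLinearMap‖

/-- Moore–Penrose pseudoinverse of a full-column-rank matrix. -/
noncomputable def pinv {m n : ℕ} (A : Matrix (Fin m) (Fin n) ℝ) : Matrix (Fin n) (Fin m) ℝ :=
  (Aᵀ * A)⁻¹ * Aᵀ

/-- Condition number κ(B) = ‖B‖ ‖B†‖. -/
noncomputable def kappa {m n : ℕ} (B : Matrix (Fin m) (Fin n) ℝ) : ℝ :=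
  spec B * spec (pinv B)

theorem vnorm_eq_norm {k : ℕ} (v : Fin k → ℝ) : vnorm v = ‖WithLp.toLp 2 v‖ := by
  simp [vnorm, EuclideanSpace.norm_eq]

theorem vnorm_nonneg {k : ℕ} (v : Fin k → ℝ) : 0 ≤ vnorm v := Real.sqrt_nonneg _

theorem spec_nonneg {m n : ℕ} (A : Matrix (Fin m) (Fin n) ℝ) : 0 ≤ spec A := norm_nonneg _

theorem vnorm_abs {k : ℕ} (v : Fin k → ℝ) : vnorm (fun i => |v i|) = vnorm v := by
  simp [vnorm]

theorem vnorm_mono {k : ℕ} {v w : Fin k → ℝ} (h : ∀ i, |v i| ≤ w i) : vnorm v ≤ vnorm w :=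
  Real.sqrt_le_sqrt (Finset.sum_le_sum fun i _ =>
    sq_le_sq.mpr ((h i).trans (le_abs_self _)))

theorem vnorm_smul {k : ℕ} {c : ℝ} (hc : 0 ≤ c) (v : Fin k → ℝ) :
    vnorm (c • v) = c * vnorm v := by
  rw [vnorm_eq_norm, vnorm_eq_norm, WithLp.toLp_smul, norm_smul, Real.norm_of_nonneg hc]

theorem vnorm_sum_le {k : ℕ} {ι : Type*} (s : Finset ι) (f : ι → Fin k → ℝ) :
    vnorm (∑ i ∈ s, f i) ≤ ∑ i ∈ s, vnorm (f i) := by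
  simp only [vnorm_eq_norm, WithLp.toLp_sum]
  exact norm_sum_le _ _

theorem abs_dotProduct_le_vnorm {k : ℕ} (v w : Fin k → ℝ) : |v ⬝ᵥ w| ≤ vnorm v * vnorm w := by
  calc |v ⬝ᵥ w| ≤ ∑ i, |v i| * |w i| := by
        simpa only [dotProduct, abs_mul] using
          Finset.abs_sum_le_sum_abs (fun i => v i * w i) Finset.univ
    _ ≤ vnorm (fun i => |v i|) * vnorm (fun i => |w i|) :=
        Real.sum_mul_le_sqrt_mul_sqrt _ _ _
    _ = vnorm v * vnorm w := by rw [vnorm_abs, vnorm_abs]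

theorem sum_abs_le_sqrt_mul_vnorm {k : ℕ} (v : Fin k → ℝ) :
    ∑ i, |v i| ≤ Real.sqrt k * vnorm v := by
  have h := Real.sum_mul_le_sqrt_mul_sqrt Finset.univ (fun _ : Fin k => (1 : ℝ)) (fun i => |v i|)
  simpa [vnorm] using h

theorem vnorm_mulVec_le {m n : ℕ} (A : Matrix (Fin m) (Fin n) ℝ) (v : Fin n → ℝ) :
    vnorm (A *ᵥ v) ≤ spec A * vnorm v := by
  rw [vnorm_eq_norm, vnorm_eq_norm]
  exact (Matrix.toEuclideanLin A).toContinuousLinearMap.le_opNorm (WithLp.toLp 2 v)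

theorem vnorm_col_le_spec {m n : ℕ} (A : Matrix (Fin m) (Fin n) ℝ) (j : Fin n) :
    vnorm (fun i => A i j) ≤ spec A := by
  have h := vnorm_mulVec_le A (Pi.single j 1)
  have h1 : vnorm (Pi.single j (1 : ℝ) : Fin n → ℝ) = 1 := by
    rw [vnorm_eq_norm]
    simp
  rw [h1, mul_one, mulVec_single_one] at h
  exact h

theorem vnorm_abs_mulVec_abs_le {m n : ℕ} (B : Matrix (Fin m) (Fin n) ℝ) (w : Fin n → ℝ) :
    vnorm (B.map (fun x => |x|) *ᵥ fun k => |w k|) ≤ Real.sqrt n * spec B * vnorm w := by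
  have hsum : (B.map (fun x => |x|) *ᵥ fun k => |w k|) = ∑ k, |w k| • fun i => |B i k| := by
    ext i
    simp [mulVec, dotProduct, mul_comm]
  rw [hsum]
  calc vnorm (∑ k, |w k| • fun i => |B i k|)
      ≤ ∑ k, vnorm (|w k| • fun i => |B i k|) := vnorm_sum_le _ _
    _ ≤ ∑ k, |w k| * spec B := Finset.sum_le_sum fun k _ => by
        rw [vnorm_smul (abs_nonneg _), vnorm_abs]
        exact mul_le_mul_of_nonneg_left (vnorm_col_le_spec B k) (abs_nonneg _)
    _ = (∑ k, |w k|) * spec B := (Finset.sum_mul _ _ _).symm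
    _ ≤ Real.sqrt n * vnorm w * spec B :=
        mul_le_mul_of_nonneg_right (sum_abs_le_sqrt_mul_vnorm w) (spec_nonneg B)
    _ = Real.sqrt n * spec B * vnorm w := by ring

theorem pinv_mul_self {m n : ℕ} (B : Matrix (Fin m) (Fin n) ℝ) (h : B.rank = n) :
    pinv B * B = 1 := by
  have hu : IsUnit (Bᵀ * B) := by
    rw [← Matrix.linearIndependent_cols_iff_isUnit, linearIndependent_iff_card_eq_finrank_span,
      Set.finrank, ← Matrix.rank_eq_finrank_span_cols, Matrix.rank_transpose_mul_self, h,
      Fintype.card_fin]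
  rw [pinv, Matrix.mul_assoc]
  exact Matrix.nonsing_inv_mul _ ((Matrix.isUnit_iff_isUnit_det _).mp hu)

/-- bound on |(Ṽᵀ Aᵀ ΔX)_{ij}|. -/
theorem stmt_9 {m n : ℕ} (A B : Matrix (Fin m) (Fin n) ℝ)
    (d : Fin n → ℝ) (hd : ∀ i, 0 < d i)
    (hA : A = B * Matrix.diagonal d) (hrank : A.rank = n)
    (V : Matrix (Fin n) (Fin n) ℝ) (hV : Vᵀ * V = 1)
    (ΔX : Matrix (Fin m) (Fin n) ℝ) (ε : ℝ) (hε : 0 ≤ ε)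
    (hΔX : ∀ i j, |ΔX i j| ≤
      ε * ((A.map (fun x => |x|) * V.map (fun x => |x|)) i j)) :
    ∀ i j, |(Vᵀ * Aᵀ * ΔX) i j| ≤ (n : ℝ) * Real.sqrt n * ε * kappa B *
      (vnorm (fun k => (A * V) k i) * vnorm (fun k => (A * V) k j)) := by
  intro i j
  have hB : B.rank = n := le_antisymm (B.rank_le_width)
    (hrank.ge.trans (hA ▸ Matrix.rank_mul_le_left _ _))
  set w : Fin n → ℝ := fun k => d k * V k j with hw
  have hBw : B *ᵥ w = fun k => (A * V) k j := by
    ext k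
    simp [hA, hw, Matrix.mul_apply, mulVec, dotProduct, mul_assoc, Matrix.diagonal_apply]
  have hw_le : vnorm w ≤ spec (pinv B) * vnorm (fun k => (A * V) k j) := by
    have h := vnorm_mulVec_le (pinv B) (B *ᵥ w)
    rwa [mulVec_mulVec, pinv_mul_self B hB, one_mulVec, hBw] at h
  have hcol : vnorm (fun k => ΔX k j) ≤
      ε * (Real.sqrt n * spec B * (spec (pinv B) * vnorm (fun k => (A * V) k j))) := by
    calc vnorm (fun k => ΔX k j)
        ≤ vnorm (ε • (B.map (fun x => |x|) *ᵥ fun k => |w k|)) := by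
          refine vnorm_mono fun k => (hΔX k j).trans_eq ?_
          simp [hA, hw, Matrix.mul_apply, mulVec, dotProduct, Matrix.diagonal_apply, abs_mul,
            mul_assoc]
      _ = ε * vnorm (B.map (fun x => |x|) *ᵥ fun k => |w k|) := vnorm_smul hε _
      _ ≤ ε * (Real.sqrt n * spec B * vnorm w) :=
          mul_le_mul_of_nonneg_left (vnorm_abs_mulVec_abs_le B w) hε
      _ ≤ _ := by
          have := spec_nonneg B
          gcongr
  have hn : (1 : ℝ) ≤ n := by
    exact_mod_cast i.pos
  have hdot : (Vᵀ * Aᵀ * ΔX) i j = (fun k => (A * V) k i) ⬝ᵥ fun k => ΔX k j := by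
    rw [← Matrix.transpose_mul]
    rfl
  have hnonneg : 0 ≤ Real.sqrt n * ε * kappa B *
      (vnorm (fun k => (A * V) k i) * vnorm (fun k => (A * V) k j)) := by
    have := vnorm_nonneg (fun k => (A * V) k i)
    have := vnorm_nonneg (fun k => (A * V) k j)
    have : 0 ≤ kappa B := mul_nonneg (spec_nonneg _) (spec_nonneg _)
    positivity
  rw [hdot]
  calc _ ≤ vnorm (fun k => (A * V) k i) * vnorm (fun k => ΔX k j) := abs_dotProduct_le_vnorm _ _
    _ ≤ _ := mul_le_mul_of_nonneg_left hcol (vnorm_nonneg _)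
    _ = Real.sqrt n * ε * kappa B *
        (vnorm (fun k => (A * V) k i) * vnorm (fun k => (A * V) k j)) := by
      rw [kappa]
      ring
    _ ≤ n * (Real.sqrt n * ε * kappa B *
        (vnorm (fun k => (A * V) k i) * vnorm (fun k => (A * V) k j))) :=
      le_mul_of_one_le_left hnonneg hn
    _ = _ := by ring
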